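/- (Discrete Allegretto–Piepenbrink theorem) Let V : ℤ^d → ℝ be bounded and E ∈ ℝ. If there exists a function u : ℤ^d → ℝ with u ≥ 0, u not identically zero, satisfying the difference equation −∑_{m:|m−n|_1=1} u(m) + V(n)u(n) = E u(n) for all n ∈ ℤ^d, then E ≤ inf σ(h_0 + V), where h_0 + V is the bounded self-adjoint operator on ℓ²(ℤ^d). -/

import Mathlib

open scoped BigOperators

noncomputable section

/-- Points of the lattice `ℤ^d`. -/
abbrev Zd (d : ℕ) := Fin d → ℤ

/-- 1-norm distance on `ℤ^d`. -/
def dist1 {d : ℕ} (x y : Zd d) : ℤ := ∑ i, |x i - y i|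

/-- The set of nearest neighbors of a point of `ℤ^d`. -/
def nbhd {d : ℕ} (n : Zd d) : Finset (Zd d) :=
  (Fintype.piFinset fun i => Finset.Icc (n i - 1) (n i + 1)).filter fun m => dist1 n m = 1

/-- `ℓ²(ℤ^d)` with real coefficients. -/
abbrev l2 (d : ℕ) := lp (fun _ : Zd d => ℝ) 2

theorem mem_nbhd {d : ℕ} {n m : Zd d} : m ∈ nbhd n ↔ dist1 n m = 1 := by
  simp only [nbhd, Finset.mem_filter, Fintype.mem_piFinset, Finset.mem_Icc, and_iff_right_iff_imp]
  intro h i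
  have h_le : |n i - m i| ≤ 1 := by
    rw [← h]
    exact Finset.single_le_sum (f := fun i => |n i - m i|) (fun j _ => abs_nonneg _)
      (Finset.mem_univ i)
  rw [abs_le] at h_le
  omega

theorem dist1_comm {d : ℕ} (x y : Zd d) : dist1 x y = dist1 y x := by
  simp only [dist1, abs_sub_comm]

theorem mem_nbhd_comm {d : ℕ} {n m : Zd d} : m ∈ nbhd n ↔ n ∈ nbhd m := by
  rw [mem_nbhd, mem_nbhd, dist1_comm]

theorem add_mem_nbhd {d : ℕ} {n e : Zd d} : n + e ∈ nbhd n ↔ e ∈ nbhd 0 := by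
  simp [mem_nbhd, dist1]

theorem neg_mem_nbhd_zero {d : ℕ} {e : Zd d} : -e ∈ nbhd 0 ↔ e ∈ nbhd 0 := by
  simp [mem_nbhd, dist1]

theorem single_mem_nbhd_zero {d : ℕ} (i : Fin d) : (Pi.single i 1 : Zd d) ∈ nbhd 0 := by
  simp [mem_nbhd, dist1, Pi.single_apply, apply_ite abs]

theorem sum_nbhd {d : ℕ} (n : Zd d) (f : Zd d → ℝ) :
    ∑ m ∈ nbhd n, f m = ∑ e ∈ nbhd 0, f (n + e) := by
  symm
  refine Finset.sum_nbij' (fun e => n + e) (fun m => m - n) ?_ ?_ ?_ ?_ ?_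
  · intro e he
    exact add_mem_nbhd.2 he
  · intro m hm
    rw [← add_mem_nbhd (n := n)]
    simpa using hm
  · simp
  · simp
  · simp

/-- Summation by parts: a sum over ordered pairs of neighbors is invariant under exchanging the
two points. -/
theorem exists_hasSum_nbhd_swap {d : ℕ} (F : Zd d → Zd d → ℝ)
    (hF : ∀ e ∈ nbhd (0 : Zd d), Summable fun n => F n (n + e)) :
    ∃ s, HasSum (fun n => ∑ m ∈ nbhd n, F n m) s ∧ HasSum (fun n => ∑ m ∈ nbhd n, F m n) s := by
  refine ⟨∑ e ∈ nbhd (0 : Zd d), ∑' n, F n (n + e), ?_, ?_⟩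
  · simp_rw [fun n => sum_nbhd n (F n)]
    exact hasSum_sum fun e he => (hF e he).hasSum
  · simp_rw [fun n => sum_nbhd n (fun m => F m n)]
    have h_neg : ∑ e ∈ nbhd (0 : Zd d), ∑' n, F n (n + e)
        = ∑ e ∈ nbhd (0 : Zd d), ∑' n, F n (n + -e) :=
      Finset.sum_nbij' (fun e => -e) (fun e => -e) (fun e he => neg_mem_nbhd_zero.2 he)
        (fun e he => neg_mem_nbhd_zero.2 he) (by simp) (by simp) (by simp)
    rw [h_neg]
    refine hasSum_sum fun e he => ?_
    have h_shift := (Equiv.addRight e).hasSum_iff.2 (hF (-e) (neg_mem_nbhd_zero.2 he)).hasSum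
    simpa [Function.comp_def] using h_shift

theorem inner_real_eq_mul (a b : ℝ) : inner ℝ a b = a * b := by
  simp [mul_comm]

theorem summable_sq_lp_two {ι : Type*} (x : lp (fun _ : ι => ℝ) 2) :
    Summable fun n => x n ^ 2 := by
  simpa [pow_two] using lp.summable_inner (𝕜 := ℝ) x x

theorem summable_mul_shift {d : ℕ} (x y : l2 d) (e : Zd d) :
    Summable fun n => x n * y (n + e) := by
  have h_shift : Summable fun n => y (n + e) ^ 2 :=
    (Equiv.addRight e).summable_iff (f := fun n => y n ^ 2) |>.2 (summable_sq_lp_two y)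
  refine .of_norm_bounded ((summable_sq_lp_two x).add h_shift) fun n => ?_
  rw [Real.norm_eq_abs, abs_le]
  constructor <;> nlinarith [sq_nonneg (x n + y (n + e)), sq_nonneg (x n - y (n + e))]

/-- A lattice Schrödinger operator is symmetric. -/
theorem isSelfAdjoint_of_apply_eq {d : ℕ} {V : Zd d → ℝ} {H : l2 d →L[ℝ] l2 d}
    (hH : ∀ (u : l2 d) (n : Zd d), (H u) n = (-∑ j ∈ nbhd n, u j) + V n * u n) :
    IsSelfAdjoint H := by
  rw [ContinuousLinearMap.isSelfAdjoint_iff_isSymmetric]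
  intro x y
  obtain ⟨s, hs, hs'⟩ := exists_hasSum_nbhd_swap (fun n m => x n * y m)
    fun e _ => summable_mul_shift x y e
  have h_left := (lp.hasSum_inner (𝕜 := ℝ) (H x) y).add hs'
  have h_right := (lp.hasSum_inner (𝕜 := ℝ) x (H y)).add hs
  have h_eq : (fun n => inner ℝ ((H x) n) (y n) + ∑ m ∈ nbhd n, x m * y n)
      = fun n => inner ℝ (x n) ((H y) n) + ∑ m ∈ nbhd n, x n * y m := by
    funext n
    simp only [hH, ← Finset.sum_mul, ← Finset.mul_sum, inner_real_eq_mul]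
    ring
  rw [h_eq] at h_left
  exact add_right_cancel (h_left.unique h_right)

/-- The Harnack-type strict positivity of non-trivial non-negative solutions. -/
theorem pos_of_nonneg_of_ne_zero {d : ℕ} {V : Zd d → ℝ} {E : ℝ} {u : Zd d → ℝ}
    (hupos : ∀ n, 0 ≤ u n) (hune : u ≠ 0)
    (hueq : ∀ n, (-∑ j ∈ nbhd n, u j) + V n * u n = E * u n) (n : Zd d) : 0 < u n := by
  refine lt_of_le_of_ne (hupos n) fun hn => hune ?_
  have h_nbhd : ∀ e ∈ nbhd (0 : Zd d), ∀ n, u n = 0 → u (n + e) = 0 := by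
    intro e he n hn
    have h_sum : ∑ j ∈ nbhd n, u j = 0 := by simpa [hn] using hueq n
    exact (Finset.sum_eq_zero_iff_of_nonneg fun j _ => hupos j).1 h_sum _ (add_mem_nbhd.2 he)
  let S : AddSubgroup (Zd d) :=
    { carrier := {v | ∀ n, u n = 0 ↔ u (n + v) = 0}
      zero_mem' := by simp
      add_mem' := by
        intro a b ha hb n
        rw [ha n, hb (n + a), add_assoc]
      neg_mem' := by
        intro a ha n
        rw [ha (n + -a), neg_add_cancel_right] }
  have h_mem : ∀ v : Zd d, v ∈ S := by
    intro v
    rw [← Finset.univ_sum_single v]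
    refine sum_mem fun i _ => ?_
    have h_single : (Pi.single i 1 : Zd d) ∈ S := fun n =>
      ⟨h_nbhd _ (single_mem_nbhd_zero i) n, fun h => by
        simpa using h_nbhd _ (neg_mem_nbhd_zero.2 (single_mem_nbhd_zero i)) _ h⟩
    have h_smul := S.zsmul_mem h_single (v i)
    rwa [← Pi.single_smul, smul_eq_mul, mul_one] at h_smul
  funext m
  simpa using (h_mem (m - n) n).1 hn.symm

/-- A positive solution at energy `E` bounds the quadratic form from below by `E`. -/
theorem mul_norm_sq_le_inner {d : ℕ} {V : Zd d → ℝ} (hV : ∃ C : ℝ, ∀ n, |V n| ≤ C) {E : ℝ}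
    {H : l2 d →L[ℝ] l2 d}
    (hH : ∀ (u : l2 d) (n : Zd d), (H u) n = (-∑ j ∈ nbhd n, u j) + V n * u n)
    {u : Zd d → ℝ} (hupos : ∀ n, 0 < u n)
    (hueq : ∀ n, (-∑ j ∈ nbhd n, u j) + V n * u n = E * u n) (x : l2 d) :
    E * ‖x‖ ^ 2 ≤ inner ℝ (H x) x := by
  obtain ⟨C, hC⟩ := hV
  have h_sum : ∀ n, ∑ m ∈ nbhd n, u m / u n = V n - E := by
    intro n
    rw [← Finset.sum_div, div_eq_iff (hupos n).ne']
    linarith [hueq n]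
  have h_ratio : ∀ n m, 0 ≤ u m / u n := fun n m => (div_pos (hupos m) (hupos n)).le
  obtain ⟨s, hs, hs'⟩ := exists_hasSum_nbhd_swap (fun n m => x n ^ 2 * (u m / u n)) (by
    intro e he
    refine .of_nonneg_of_le (fun n => mul_nonneg (sq_nonneg _) (h_ratio _ _)) (fun n => ?_)
      ((summable_sq_lp_two x).mul_right (C + |E|))
    refine mul_le_mul_of_nonneg_left ?_ (sq_nonneg _)
    calc u (n + e) / u n ≤ ∑ m ∈ nbhd n, u m / u n :=
          Finset.single_le_sum (f := fun m => u m / u n) (fun m _ => h_ratio n m)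
            (add_mem_nbhd.2 he)
      _ = V n - E := h_sum n
      _ ≤ C + |E| := by linarith [le_abs_self (V n), hC n, neg_abs_le E])
  have h_norm := (lp.hasSum_inner (𝕜 := ℝ) x x).mul_left E
  rw [real_inner_self_eq_norm_sq] at h_norm
  have h_le := hasSum_le (fun n => ?_) ((h_norm.mul_left 2).add hs)
    (((lp.hasSum_inner (𝕜 := ℝ) (H x) x).mul_left 2).add hs')
  · linarith
  have h_pair : ∀ m, 2 * (x n * x m) ≤ x n ^ 2 * (u m / u n) + x m ^ 2 * (u n / u m) := by
    intro m
    have hn := hupos n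
    have hm := hupos m
    have h_sq : x n ^ 2 * (u m / u n) + x m ^ 2 * (u n / u m) - 2 * (x n * x m)
        = (x n * u m - x m * u n) ^ 2 / (u n * u m) := by
      field_simp
      ring
    have : 0 ≤ (x n * u m - x m * u n) ^ 2 / (u n * u m) := by positivity
    linarith
  have h_pairs := Finset.sum_le_sum fun m (_ : m ∈ nbhd n) => h_pair m
  rw [Finset.sum_add_distrib, ← Finset.mul_sum, ← Finset.mul_sum, ← Finset.mul_sum, h_sum]
    at h_pairs
  simp only [hH, ← Finset.mul_sum, h_sum, inner_real_eq_mul]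
  nlinarith [h_pairs]

/-- The real spectrum of a self-adjoint operator on a non-trivial Hilbert space is non-empty. -/
theorem spectrum_nonempty_of_isSelfAdjoint {X : Type*} [NormedAddCommGroup X]
    [InnerProductSpace ℝ X] [CompleteSpace X] [Nontrivial X] {T : X →L[ℝ] X}
    (hT : IsSelfAdjoint T) : (spectrum ℝ T).Nonempty := by
  by_contra h
  rw [Set.not_nonempty_iff_eq_empty] at h
  have h_radius := ContinuousLinearMap.spectralRadius_eq_nnnorm T hT
  have h_zero : T = 0 := by simpa [spectralRadius, h] using h_radius.symm
  simp [h_zero, spectrum.zero_eq] at h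

/-- A lower bound of the quadratic form is a lower bound of the real spectrum. -/
theorem le_of_mem_spectrum_of_le_inner {X : Type*} [NormedAddCommGroup X]
    [InnerProductSpace ℝ X] [CompleteSpace X] {T : X →L[ℝ] X} {E : ℝ}
    (hT : ∀ x, E * ‖x‖ ^ 2 ≤ inner ℝ (T x) x) {t : ℝ} (ht : t ∈ spectrum ℝ T) : E ≤ t := by
  by_contra! hlt
  refine ht ?_
  rw [spectrum.mem_resolventSet_iff, ← IsUnit.neg_iff, neg_sub]
  refine ContinuousLinearMap.isUnit_of_forall_le_norm_inner_map (𝕜 := ℝ) _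
    (c := ⟨E - t, (sub_pos.2 hlt).le⟩) (sub_pos.2 hlt) fun x => ?_
  calc ‖x‖ ^ 2 * (E - t) ≤ inner ℝ (T x) x - t * ‖x‖ ^ 2 := by linarith [hT x]
    _ = inner ℝ ((T - algebraMap ℝ (X →L[ℝ] X) t) x) x := by
      simp [Algebra.algebraMap_eq_smul_one, inner_sub_left, real_inner_smul_left]
    _ ≤ _ := Real.le_norm_self _

/-- **Discrete Allegretto–Piepenbrink theorem.**  Let `V : ℤ^d → ℝ` be bounded and let
`h₀ + V` be the corresponding bounded self-adjoint operator on `ℓ²(ℤ^d)`.  If there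
exists a non-trivial `u ≥ 0` (not necessarily in `ℓ²`) satisfying the difference
equation `-∑_{|m-n|₁=1} u(m) + V(n)u(n) = E u(n)` for all `n`, then
`E ≤ inf σ(h₀ + V)`. -/
theorem discrete_allegretto_piepenbrink
    (d : ℕ) (hd : 1 ≤ d)
    (V : Zd d → ℝ) (hV : ∃ C : ℝ, ∀ n, |V n| ≤ C)
    (E : ℝ)
    (H : l2 d →L[ℝ] l2 d)
    (hH : ∀ (u : l2 d) (n : Zd d),
      (H u) n = (-∑ j ∈ nbhd n, u j) + V n * u n)
    (u : Zd d → ℝ)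
    (hupos : ∀ n, 0 ≤ u n) (hune : u ≠ 0)
    (hueq : ∀ n, (-∑ j ∈ nbhd n, u j) + V n * u n = E * u n) :
    E ≤ sInf (spectrum ℝ H) := by
  have hu := pos_of_nonneg_of_ne_zero hupos hune hueq
  have : Nontrivial (l2 d) := by
    refine ⟨lp.single 2 0 1, 0, fun h => ?_⟩
    simpa using congrArg (fun f : l2 d => f 0) h
  exact le_csInf (spectrum_nonempty_of_isSelfAdjoint (isSelfAdjoint_of_apply_eq hH)) fun t ht =>
    le_of_mem_spectrum_of_le_inner (mul_norm_sq_le_inner hV hH hu hueq) ht
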